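/- arXiv:0903.4839 — 2 statements merged into one kernel-verified Lean document; each statement's English description precedes it below -/
import Mathlib

section
/- Let K be a field, A = K[x₁,…,xₙ], and φ a K-algebra endomorphism of A with trdeg_K(image φ) = m, where 2 ≤ m ≤ n. Then there exists a K-algebra endomorphism ψ of A with ker ψ = ker φ such that every ψ(x_i) lies in the subalgebra K[x₁,…,x_m] generated by the first m variables. Moreover, letting ψ'_r (for r ∈ ℕ) be the K-algebra endomorphism of A with ψ'_r(x_i) obtained from ψ(x_i) by substituting x₁^r for x_m (leaving the other variables fixed), one has trdeg_K(image ψ'_r) ≤ m − 1 for every r, and there exists r₀ ∈ ℕ such that for all r ≥ r₀: ker ψ ⊊ ker ψ'_r and trdeg_K(image ψ'_r) = m − 1. -/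
open MvPolynomial

/-- The transcendence degree of an algebra `A` over `K`: the supremum of cardinalities of
algebraically independent subsets (mirrors Mathlib's `Algebra.trdeg`). -/
noncomputable def algTrdeg (K A : Type*) [CommRing K] [CommRing A] [Algebra K A] : Cardinal :=
  ⨆ ι : { s : Set A // AlgebraicIndependent K ((↑) : s → A) }, Cardinal.mk ι.1


/-- The endomorphism of `K[x₁,…,xₙ]` fixing every variable except `x_m` (the variable of
index `m - 1`), which is sent to `x₁^r`. -/
noncomputable def substVar (K : Type) [Field K] (n m : ℕ) (h0 : 0 < n) (r : ℕ) :
    MvPolynomial (Fin n) K →ₐ[K] MvPolynomial (Fin n) K :=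
  MvPolynomial.aeval fun j : Fin n =>
    if (j : ℕ) = m - 1 then (MvPolynomial.X (⟨0, h0⟩ : Fin n)) ^ r else MvPolynomial.X j

universe u

/-- If `a` and `y` satisfy a nonzero polynomial relation over `S`, then for a suitable exponent `N`
every valuation that is trivial on `S` and bounded on `a + y ^ N` is bounded on `a` and on `y`. -/
theorem exists_pow_forall_valuation_le_one {S B : Type u} [CommRing S] [CommRing B] [Algebra S B]
    {a y : B} (h : ¬ AlgebraicIndependent S ![a, y]) :
    ∃ N : ℕ, ∀ (Γ : Type u) [LinearOrderedCommGroupWithZero Γ] (v : Valuation B Γ),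
      (∀ s : S, s ≠ 0 → v (algebraMap S B s) = 1) → v (a + y ^ N) ≤ 1 → v a ≤ 1 ∧ v y ≤ 1 := by
  classical
  rw [algebraicIndependent_iff] at h
  push Not at h
  obtain ⟨p, hp, hp0⟩ := h
  refine ⟨p.totalDegree + 1, fun Γ _ v hv hw => ?_⟩
  set N := p.totalDegree + 1 with hN
  have ha : a = (a + y ^ N) - y ^ N := by ring
  suffices hy : v y ≤ 1 by
    refine ⟨?_, hy⟩
    rw [ha]
    exact v.map_sub_le hw (by rw [map_pow]; exact pow_le_one' hy N)
  by_contra! hy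
  have hva : v a = v y ^ N := by
    rw [← map_pow, ha]
    refine v.map_sub_eq_of_lt_right (hw.trans_lt ?_)
    rw [map_pow]
    exact one_lt_pow₀ hy (by omega)
  have hterm : ∀ d ∈ p.support,
      v (algebraMap S B (p.coeff d) * ∏ i, ![a, y] i ^ d i) = v y ^ (N * d 0 + d 1) := by
    intro d hd
    rw [map_mul, hv _ (mem_support_iff.mp hd), one_mul, Fin.prod_univ_two]
    simp [hva, pow_add, pow_mul]
  obtain ⟨d, hd, hmax⟩ := Finset.exists_max_image p.support (fun d => N * d 0 + d 1)
    (support_nonempty.mpr hp0)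
  have hlt : ∀ e ∈ p.support, e 1 < N := fun e he => by
    have := le_totalDegree he
    rw [Finsupp.sum_fintype _ _ (fun _ => rfl), Fin.sum_univ_two] at this
    omega
  have hsum := v.map_sum_eq_of_lt
    (f := fun d => algebraMap S B (p.coeff d) * ∏ i, ![a, y] i ^ d i) hd (by
    intro e he
    rw [Finset.mem_sdiff, Finset.mem_singleton] at he
    rw [hterm e he.1, hterm d hd]
    refine pow_lt_pow_right₀ hy (lt_of_le_of_ne (hmax e he.1) fun heq => he.2 ?_)
    have h1 := hlt e he.1
    have h2 := hlt d hd
    have h3 : e 0 = d 0 := by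
      have := congrArg (· / N) heq
      simpa [Nat.mul_add_div (by omega : N > 0), Nat.div_eq_of_lt h1, Nat.div_eq_of_lt h2]
        using this
    ext i
    fin_cases i
    · exact h3
    · rw [h3] at heq
      simpa using heq)
  rw [← eval₂_eq', ← aeval_def, hp, map_zero, hterm d hd] at hsum
  exact pow_ne_zero _ (zero_lt_one.trans hy).ne' hsum.symm

/-- Iteration of `exists_pow_forall_valuation_le_one` over a finite set of elements `y i`. -/
theorem exists_pow_sum_forall_valuation_le_one {S B : Type u} {ι : Type*} [CommRing S] [CommRing B]
    [Algebra S B] (y : ι → B) (h : ∀ b i, ¬ AlgebraicIndependent S ![b, y i]) (a : B)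
    (t : Finset ι) :
    ∃ N : ι → ℕ, ∀ (Γ : Type u) [LinearOrderedCommGroupWithZero Γ] (v : Valuation B Γ),
      (∀ s : S, s ≠ 0 → v (algebraMap S B s) = 1) → v (a + ∑ i ∈ t, y i ^ N i) ≤ 1 →
        v a ≤ 1 ∧ ∀ i ∈ t, v (y i) ≤ 1 := by
  classical
  induction t using Finset.induction_on with
  | empty => exact ⟨0, fun Γ _ v _ hw => by simpa using hw⟩
  | insert j t hj ih =>
    obtain ⟨N, hN⟩ := ih
    obtain ⟨M, hM⟩ := exists_pow_forall_valuation_le_one (h (a + ∑ i ∈ t, y i ^ N i) j)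
    refine ⟨Function.update N j M, fun Γ _ v hv hw => ?_⟩
    rw [Finset.sum_insert hj, Function.update_self, add_left_comm, add_comm,
      Finset.sum_congr rfl fun i hi => by
        rw [Function.update_of_ne (ne_of_mem_of_not_mem hi hj)]] at hw
    obtain ⟨h1, h2⟩ := hM Γ v hv hw
    obtain ⟨h3, h4⟩ := hN Γ v hv h1
    exact ⟨h3, Finset.forall_mem_insert _ _ _ |>.mpr ⟨h2, h4⟩⟩

/-- A transcendental element of an extension field lies outside some valuation ring in which the
nonzero base elements are units and which contains all algebraic elements. -/
theorem exists_valuationSubring_notMem {S F : Type u} [CommRing S] [IsDomain S] [Field F]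
    [Algebra S F] [FaithfulSMul S F] {x : F} (hx : Transcendental S x) :
    ∃ V : ValuationSubring F,
      (∀ s : S, s ≠ 0 → V.valuation (algebraMap S F s) = 1) ∧
      (∀ c : F, IsAlgebraic S c → V.valuation c ≤ 1) ∧ 1 < V.valuation x := by
  let := FractionRing.liftAlgebra S F
  have := FractionRing.isScalarTower_liftAlgebra S F
  have hx' : x ∉ (integralClosure (FractionRing S) F).toSubring := fun hmem =>
    hx ((IsFractionRing.isAlgebraic_iff S (FractionRing S) F).mpr
      (IsIntegral.isAlgebraic hmem))
  obtain ⟨V, hV, hxV⟩ := Subring.exists_le_valuationSubring_of_isIntegrallyClosedIn hx'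
  refine ⟨V, fun s hs => ?_, fun c hc => ?_, ?_⟩
  · have hmem : ∀ c : FractionRing S, V.valuation (algebraMap _ F c) ≤ 1 := fun c =>
      (V.valuation_le_one_iff _).mpr (hV (algebraMap_mem (integralClosure _ F) c))
    have hs' : algebraMap S (FractionRing S) s ≠ 0 := by simpa using hs
    rw [IsScalarTower.algebraMap_apply S (FractionRing S) F]
    refine le_antisymm (hmem _) ?_
    have h1 := hmem (algebraMap S (FractionRing S) s)⁻¹
    rw [map_inv₀, map_inv₀] at h1
    exact (inv_le_one₀ (zero_lt_iff.mpr (by simpa using hs))).mp h1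
  · exact (V.valuation_le_one_iff _).mpr
      (hV ((IsFractionRing.isAlgebraic_iff S _ F).mp hc).isIntegral)
  · rw [← not_le, V.valuation_le_one_iff]
    exact hxV

/-- Nagata's trick, for a domain `B` of transcendence degree one over `S`: for a suitable choice of
exponents, the element `a + ∑ y i ^ N i` divides no nonzero element of `S`. -/
theorem exists_pow_sum_not_dvd {S B : Type u} {ι : Type*} [CommRing S] [CommRing B]
    [IsDomain S] [IsDomain B] [Algebra S B] [FaithfulSMul S B] [Fintype ι] (y : ι → B)
    (h : ∀ b i, ¬ AlgebraicIndependent S ![b, y i]) (a : B) (hS : ¬ Algebra.IsAlgebraic S B)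
    (hgen : Algebra.adjoin S (insert a (Set.range y)) = ⊤) :
    ∃ N : ι → ℕ, ∀ s : S, s ≠ 0 → ¬ a + ∑ i, y i ^ N i ∣ algebraMap S B s := by
  let F := FractionRing B
  obtain ⟨N, hN⟩ := exists_pow_sum_forall_valuation_le_one (S := S) y h a Finset.univ
  replace hN : ∀ (V : ValuationSubring F),
      (∀ s : S, s ≠ 0 → V.valuation (algebraMap S F s) = 1) →
      V.valuation (algebraMap B F (a + ∑ i, y i ^ N i)) ≤ 1 →
      ∀ b, V.valuation (algebraMap B F b) ≤ 1 := fun V hV hw => by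
    have hV' : ∀ s : S, s ≠ 0 →
        V.valuation.comap (algebraMap B F) (algebraMap S B s) = 1 := fun s hs => by
      rw [← hV s hs, IsScalarTower.algebraMap_apply S B F]; rfl
    obtain ⟨h1, h2⟩ := hN _ (V.valuation.comap (algebraMap B F)) hV' hw
    intro b
    induction (hgen ▸ Algebra.mem_top : b ∈ Algebra.adjoin S (insert a (Set.range y)))
      using Algebra.adjoin_induction with
    | mem x hx =>
      obtain rfl | ⟨i, rfl⟩ := hx
      · exact h1
      · exact h2 i (Finset.mem_univ i)
    | algebraMap s =>
      obtain rfl | hs := eq_or_ne s 0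
      · simp
      · exact (hV' s hs).le
    | add x z _ _ hx hz => rw [map_add]; exact V.valuation.map_add_le hx hz
    | mul x z _ _ hx hz => rw [map_mul, map_mul]; exact mul_le_one' hx hz
  refine ⟨N, fun s hs hdvd => ?_⟩
  set w := a + ∑ i, y i ^ N i
  have hw : Transcendental S (algebraMap B F w) := by
    intro hw
    obtain ⟨b, hb⟩ := not_forall.mp (mt Algebra.IsAlgebraic.mk hS)
    have hb' : Transcendental S (algebraMap B F b) := fun hb' =>
      hb ((isAlgebraic_algebraMap_iff (IsFractionRing.injective B F)).mp hb')
    obtain ⟨V, hV, hValg, hVb⟩ := exists_valuationSubring_notMem hb'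
    exact hVb.not_ge (hN V hV (hValg _ hw) b)
  have hw' : Transcendental S (algebraMap B F w)⁻¹ := fun h =>
    hw (inv_inv (algebraMap B F w) ▸ h.inv)
  obtain ⟨V, hV, -, hVw⟩ := exists_valuationSubring_notMem hw'
  obtain ⟨b, hb⟩ := hdvd
  have hw1 : V.valuation (algebraMap B F w) < 1 := by
    rw [map_inv₀] at hVw
    exact (one_lt_inv_iff₀.mp hVw).2
  have h1 := hV s hs
  rw [IsScalarTower.algebraMap_apply S B F, hb, map_mul, map_mul] at h1
  exact (mul_lt_one_of_lt_of_le hw1 (hN V hV hw1.le b)).ne h1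

theorem exists_subalgebra_trdeg_le_one {R B : Type u} [CommRing R] [CommRing B] [IsDomain R]
    [IsDomain B] [Algebra R B] [FaithfulSMul R B] (h : ¬ Algebra.IsAlgebraic R B) :
    ∃ S : Subalgebra R B, ¬ Algebra.IsAlgebraic S B ∧ Algebra.trdeg S B ≤ 1 := by
  obtain ⟨s, hs⟩ := exists_isTranscendenceBasis R B
  have hne : s.Nonempty := by
    rw [Set.nonempty_iff_ne_empty]
    rintro rfl
    exact h (hs.isEmpty_iff_isAlgebraic.mp inferInstance)
  obtain ⟨a, ha⟩ := hne
  refine ⟨Algebra.adjoin R (s \ {a}), fun halg => ?_, ?_⟩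
  · have := hs.1.transcendental_adjoin (s := {⟨a, ha⟩}ᶜ) (i := ⟨a, ha⟩) (by simp)
    refine this ?_
    have himg : (Subtype.val '' ({⟨a, ha⟩}ᶜ : Set s)) = s \ {a} := by
      ext x; simp
    rw [himg]
    exact halg.isAlgebraic a
  · have hB := hs.isAlgebraic
    rw [Subtype.range_val] at hB
    have : Algebra.IsAlgebraic (Algebra.adjoin (Algebra.adjoin R (s \ {a})) {a}) B := by
      rw [← Set.sdiff_union_of_subset (Set.singleton_subset_iff.mpr ha),
        Algebra.adjoin_union_eq_adjoin_adjoin] at hB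
      exact hB
    simpa using Algebra.IsAlgebraic.trdeg_le_cardinalMk
      (R := Algebra.adjoin R (s \ {a})) (s := ({a} : Set B))

theorem X_add_dvd_of_aeval_eq_zero {K : Type u} [CommRing K] {k : ℕ} (q : MvPolynomial (Fin k) K)
    {p : MvPolynomial (Fin (k + 1)) K}
    (hp : aeval (Fin.cons (-q) X : Fin (k + 1) → MvPolynomial (Fin k) K) p = 0) :
    X 0 + rename Fin.succ q ∣ p := by
  rw [← Ideal.mem_span_singleton, ← Ideal.Quotient.eq_zero_iff_mem]
  let J := Ideal.span {X 0 + rename Fin.succ q}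
  have : Ideal.Quotient.mkₐ K J = ((Ideal.Quotient.mkₐ K J).comp (rename Fin.succ)).comp
      (aeval (Fin.cons (-q) X : Fin (k + 1) → MvPolynomial (Fin k) K)) := by
    ext i
    refine Fin.cases ?_ (fun j => ?_) i
    · simp only [AlgHom.comp_apply, aeval_X, Fin.cons_zero, Ideal.Quotient.mkₐ_eq_mk]
      rw [Ideal.Quotient.eq, map_neg, sub_neg_eq_add]
      exact Ideal.mem_span_singleton_self _
    · simp
  have h2 := DFunLike.congr_fun this p
  rw [AlgHom.comp_apply, hp, map_zero] at h2
  exact h2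

/-- A subalgebra over which the polynomial ring in `k + 1` variables is not algebraic embeds in the
polynomial ring in `k` variables. -/
theorem exists_algHom_injOn_of_not_isAlgebraic {K : Type u} [Field K] {k : ℕ}
    (R : Subalgebra K (MvPolynomial (Fin (k + 1)) K))
    (hR : ¬ Algebra.IsAlgebraic R (MvPolynomial (Fin (k + 1)) K)) :
    ∃ θ : MvPolynomial (Fin (k + 1)) K →ₐ[K] MvPolynomial (Fin k) K,
      ∀ p ∈ R, θ p = 0 → p = 0 := by
  obtain ⟨S, hS, hS1⟩ := exists_subalgebra_trdeg_le_one hR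
  have hdep : ∀ (b : MvPolynomial (Fin (k + 1)) K) (i : Fin k),
      ¬ AlgebraicIndependent S ![b, X i.succ] := fun b i hind => by
    have := hind.lift_cardinalMk_le_trdeg.trans (Cardinal.lift_le.mpr hS1)
    simp at this
  have hgen : Algebra.adjoin S (insert (X 0 : MvPolynomial (Fin (k + 1)) K)
      (Set.range fun i : Fin k => X i.succ)) = ⊤ := by
    have hX : (insert (X 0 : MvPolynomial (Fin (k + 1)) K)
        (Set.range fun i : Fin k => X i.succ)) = Set.range X := by
      ext p; simp [Fin.exists_fin_succ, eq_comm]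
    rw [hX, eq_top_iff]
    intro p _
    have hp : p ∈ Algebra.adjoin K
        (Set.range (X : Fin (k + 1) → MvPolynomial (Fin (k + 1)) K)) := by
      rw [adjoin_range_X]; trivial
    induction hp using Algebra.adjoin_induction with
    | mem x hx => exact Algebra.subset_adjoin hx
    | algebraMap c =>
      exact Subalgebra.algebraMap_mem _ (⟨_, S.algebraMap_mem (algebraMap K R c)⟩ : S)
    | add x y _ _ hx hy => exact add_mem (hx trivial) (hy trivial)
    | mul x y _ _ hx hy => exact mul_mem (hx trivial) (hy trivial)
  obtain ⟨N, hN⟩ := exists_pow_sum_not_dvd (S := S) _ hdep (X 0) hS hgen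
  refine ⟨aeval (Fin.cons (-∑ i, X i ^ N i) X : Fin (k + 1) → MvPolynomial (Fin k) K),
    fun p hp h0 => by_contra fun hne => ?_⟩
  refine hN ⟨p, S.algebraMap_mem ⟨p, hp⟩⟩ (by simpa [Subtype.ext_iff] using hne) ?_
  simpa using X_add_dvd_of_aeval_eq_zero _ h0

theorem Subalgebra.trdeg_eq_of_isAlgebraic {K B : Type u} [Field K] [CommRing B] [IsDomain B]
    [Algebra K B] (S : Subalgebra K B) [Algebra.IsAlgebraic S B] :
    Algebra.trdeg K S = Algebra.trdeg K B := by
  rw [← _root_.trdeg_add_eq K S (A := B), trdeg_eq_zero (R := S), add_zero]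

theorem AlgHom.trdeg_range_eq_of_ker_eq {K A B C : Type u} [Field K] [CommRing A] [CommRing B]
    [CommRing C] [Algebra K A] [Algebra K B] [Algebra K C] {f : A →ₐ[K] B} {g : A →ₐ[K] C}
    (h : RingHom.ker f = RingHom.ker g) : Algebra.trdeg K f.range = Algebra.trdeg K g.range :=
  AlgEquiv.trdeg_eq <| (Ideal.quotientKerEquivRange f).symm.trans <|
    (Ideal.quotientEquivAlgOfEq K h).trans (Ideal.quotientKerEquivRange g)

theorem exists_ker_eq_and_isAlgebraic_range {K A : Type u} [Field K] [CommRing A] [Algebra K A]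
    {k : ℕ} (φ : A →ₐ[K] MvPolynomial (Fin k) K) :
    ∃ (l : ℕ) (ψ : A →ₐ[K] MvPolynomial (Fin l) K), RingHom.ker ψ = RingHom.ker φ ∧
      Algebra.IsAlgebraic ψ.range (MvPolynomial (Fin l) K) := by
  induction k with
  | zero =>
    refine ⟨0, φ, rfl, ⟨fun p => ?_⟩⟩
    obtain ⟨c, rfl⟩ := C_surjective (Fin 0) p
    exact isAlgebraic_algebraMap (algebraMap K φ.range c)
  | succ k ih =>
    by_cases halg : Algebra.IsAlgebraic φ.range (MvPolynomial (Fin (k + 1)) K)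
    · exact ⟨k + 1, φ, rfl, halg⟩
    · obtain ⟨θ, hθ⟩ := exists_algHom_injOn_of_not_isAlgebraic φ.range halg
      obtain ⟨l, ψ, hψ, h⟩ := ih (θ.comp φ)
      refine ⟨l, ψ, hψ.trans (Ideal.ext fun a => ?_), h⟩
      exact ⟨fun ha => hθ _ ⟨a, rfl⟩ ha, fun ha => by
        rw [RingHom.mem_ker] at ha ⊢
        rw [AlgHom.comp_apply, ha, map_zero]⟩

/-- A homomorphism of rank `m` to a polynomial ring has the same kernel as one to the polynomial
ring in `m` variables. -/
theorem exists_ker_eq_of_trdeg_range_eq {K A : Type u} [Field K] [CommRing A] [Algebra K A]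
    {k m : ℕ} (φ : A →ₐ[K] MvPolynomial (Fin k) K) (hφ : Algebra.trdeg K φ.range = m) :
    ∃ ψ : A →ₐ[K] MvPolynomial (Fin m) K, RingHom.ker ψ = RingHom.ker φ ∧
      Algebra.IsAlgebraic ψ.range (MvPolynomial (Fin m) K) := by
  obtain ⟨l, ψ, hψ, halg⟩ := exists_ker_eq_and_isAlgebraic_range φ
  have h := Subalgebra.trdeg_eq_of_isAlgebraic ψ.range
  rw [AlgHom.trdeg_range_eq_of_ker_eq hψ, hφ] at h
  obtain rfl : m = l := by simpa using h
  exact ⟨ψ, hψ, halg⟩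

/-- The specialization of the last variable of a polynomial ring to `q`. -/
noncomputable def specializeLast {K : Type u} [CommRing K] {k : ℕ} (q : MvPolynomial (Fin k) K) :
    MvPolynomial (Fin (k + 1)) K →ₐ[K] MvPolynomial (Fin k) K :=
  aeval (Fin.snoc X q : Fin (k + 1) → MvPolynomial (Fin k) K)

theorem finite_specializeLast_eq_zero {K : Type u} [Field K] {k : ℕ}
    {c : MvPolynomial (Fin (k + 1)) K} (hc : c ≠ 0) :
    {q : MvPolynomial (Fin k) K | specializeLast q c = 0}.Finite := by
  classical
  let E := (renameEquiv K (finSuccEquivLast (n := k))).trans (optionEquivLeft K (Fin k))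
  have hE : E c ≠ 0 := by simpa using hc
  refine (E c).roots.toFinset.finite_toSet.subset fun q hq => ?_
  have h : specializeLast q =
      ((Polynomial.aeval q : Polynomial (MvPolynomial (Fin k) K) →ₐ[MvPolynomial (Fin k) K]
        MvPolynomial (Fin k) K).restrictScalars K).comp E.toAlgHom := by
    ext i
    refine Fin.lastCases ?_ (fun j => ?_) i <;> simp [specializeLast, E]
  rw [Set.mem_ofPred_eq, h] at hq
  simpa [hE] using hq

theorem eventually_specializeLast_ne_zero {K : Type u} [Field K] {k : ℕ}
    {c : MvPolynomial (Fin (k + 1)) K} (hc : c ≠ 0) {q : ℕ → MvPolynomial (Fin k) K}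
    (hq : Function.Injective q) : ∀ᶠ r in Filter.atTop, specializeLast (q r) c ≠ 0 := by
  rw [← Nat.cofinite_eq_atTop]
  exact hq.tendsto_cofinite.eventually (finite_specializeLast_eq_zero hc).eventually_cofinite_notMem

/-- Algebraicity of the polynomial ring over the range of `ψ` is preserved by all but finitely many
of a sequence of distinct specializations of the last variable. -/
theorem eventually_isAlgebraic_range_specializeLast_comp {K A : Type u} [Field K] [CommRing A]
    [Algebra K A] {k : ℕ} (ψ : A →ₐ[K] MvPolynomial (Fin (k + 1)) K)
    [hψ : Algebra.IsAlgebraic ψ.range (MvPolynomial (Fin (k + 1)) K)]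
    {q : ℕ → MvPolynomial (Fin k) K} (hq : Function.Injective q) :
    ∀ᶠ r in Filter.atTop, Algebra.IsAlgebraic ((specializeLast (q r)).comp ψ).range
      (MvPolynomial (Fin k) K) := by
  have hX : ∀ j : Fin k, ∀ᶠ r in Filter.atTop,
      IsAlgebraic ((specializeLast (q r)).comp ψ).range (X j : MvPolynomial (Fin k) K) := by
    intro j
    obtain ⟨p, hp, hp0⟩ := hψ.isAlgebraic (X j.castSucc)
    have hc : (p.leadingCoeff : MvPolynomial (Fin (k + 1)) K) ≠ 0 := by simpa using hp
    filter_upwards [eventually_specializeLast_ne_zero hc hq] with r hr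
    let f : ψ.range →ₐ[K] ((specializeLast (q r)).comp ψ).range :=
      ((specializeLast (q r)).comp ψ.range.val).codRestrict _ (by
        rintro ⟨_, a, rfl⟩
        exact ⟨a, rfl⟩)
    refine ⟨p.map f.toRingHom, fun h => hr ?_, ?_⟩
    · have := congrArg (fun g => (g.coeff p.natDegree : MvPolynomial (Fin k) K)) h
      simpa [f] using this
    · have h := congrArg (specializeLast (q r)) hp0
      rw [map_zero, Polynomial.aeval_def, ← AlgHom.coe_toRingHom, Polynomial.hom_eval₂] at h
      rw [Polynomial.aeval_def, Polynomial.eval₂_map, ← h]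
      congr 1
      simp [specializeLast]
  filter_upwards [Filter.eventually_all.mpr hX] with r hr
  refine ⟨fun p => ?_⟩
  have hp : p ∈ Algebra.adjoin K (Set.range (X : Fin k → MvPolynomial (Fin k) K)) := by
    rw [adjoin_range_X]; trivial
  induction hp using Algebra.adjoin_induction with
  | mem x hx => obtain ⟨j, rfl⟩ := hx; exact hr j
  | algebraMap c => exact isAlgebraic_algebraMap (algebraMap K
      ((specializeLast (q r)).comp ψ).range c)
  | add x y _ _ hx hy => exact hx.add hy
  | mul x y _ _ hx hy => exact hx.mul hy

theorem trdeg_eq_algTrdeg (K A : Type u) [CommRing K] [CommRing A] [Algebra K A] :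
    algTrdeg K A = Algebra.trdeg K A := rfl

/-- For an endomorphism `φ` of rank `m` (`2 ≤ m ≤ n`) there is an endomorphism `ψ` with the
same kernel whose values lie in `K[x₁,…,x_m]`; substituting `x₁^r` for `x_m` in `ψ` always
gives rank at most `m - 1`, and for all sufficiently large `r` it gives an endomorphism with
strictly larger kernel and rank exactly `m - 1`. -/
theorem stmt_9 (K : Type) [Field K] (n m : ℕ) (hm : 2 ≤ m) (hmn : m ≤ n)
    (φ : MvPolynomial (Fin n) K →ₐ[K] MvPolynomial (Fin n) K)
    (hφ : algTrdeg K ↥φ.range = (m : Cardinal)) :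
    ∃ ψ : MvPolynomial (Fin n) K →ₐ[K] MvPolynomial (Fin n) K,
      RingHom.ker ψ = RingHom.ker φ ∧
      (∀ i : Fin n, ψ (MvPolynomial.X i) ∈
        Algebra.adjoin K {p : MvPolynomial (Fin n) K |
          ∃ j : Fin n, (j : ℕ) < m ∧ p = MvPolynomial.X j}) ∧
      (∀ r : ℕ,
        algTrdeg K ↥((substVar K n m (by omega) r).comp ψ).range ≤ ((m - 1 : ℕ) : Cardinal)) ∧
      (∃ r₀ : ℕ, ∀ r : ℕ, r₀ ≤ r →
        RingHom.ker ψ < RingHom.ker ((substVar K n m (by omega) r).comp ψ) ∧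
        algTrdeg K ↥((substVar K n m (by omega) r).comp ψ).range = ((m - 1 : ℕ) : Cardinal)) := by
  obtain ⟨k, rfl⟩ : ∃ k, m = k + 2 := ⟨m - 2, by omega⟩
  obtain ⟨ψ, hψ, halg⟩ := exists_ker_eq_of_trdeg_range_eq φ hφ
  let q : ℕ → MvPolynomial (Fin (k + 1)) K := fun r => X 0 ^ r
  have hq : Function.Injective q := fun r s h => by
    have := congrArg totalDegree h
    simpa [q] using this
  have hcomp : ∀ r, (substVar K n (k + 2) (by omega) r).comp (rename (Fin.castLE hmn)) =
      (rename (Fin.castLE (by omega : k + 1 ≤ n))).comp (specializeLast (q r)) := by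
    intro r
    ext1 i
    refine Fin.lastCases ?_ (fun j => ?_) i
    · simp [substVar, specializeLast, q]
      rfl
    · simp [substVar, specializeLast, j.2.ne]
  have hker_rename : ∀ {l : ℕ} (hl : l ≤ n)
      (f : MvPolynomial (Fin n) K →ₐ[K] MvPolynomial (Fin l) K),
      RingHom.ker ((rename (Fin.castLE hl)).comp f) = RingHom.ker f := fun hl f =>
    Ideal.ext fun p => map_eq_zero_iff (rename (Fin.castLE hl) : _ →ₐ[K] _)
      (rename_injective _ (Fin.castLE_injective hl))
  have hker : ∀ r, RingHom.ker ((substVar K n (k + 2) (by omega) r).comp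
      ((rename (Fin.castLE hmn)).comp ψ)) = RingHom.ker ((specializeLast (q r)).comp ψ) := by
    intro r
    rw [← AlgHom.comp_assoc, hcomp, AlgHom.comp_assoc, hker_rename]
  have htr := fun r => AlgHom.trdeg_range_eq_of_ker_eq (hker r)
  refine ⟨(rename (Fin.castLE hmn)).comp ψ, (hker_rename hmn ψ).trans hψ, fun i => ?_, fun r => ?_,
    ?_⟩
  · rw [AlgHom.comp_apply]
    generalize ψ (X i) = p
    have hp : rename (Fin.castLE hmn) p ∈ (⊤ : Subalgebra K _).map (rename (Fin.castLE hmn)) :=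
      ⟨p, trivial, rfl⟩
    rw [← adjoin_range_X, AlgHom.map_adjoin] at hp
    refine Algebra.adjoin_mono ?_ hp
    rintro _ ⟨_, ⟨j, rfl⟩, rfl⟩
    exact ⟨Fin.castLE hmn j, j.2, rename_X _ _⟩
  · rw [trdeg_eq_algTrdeg, htr]
    simpa using trdeg_le_of_injective
      ((specializeLast (q r)).comp ψ).range.val Subtype.val_injective
  · obtain ⟨r₀, h₀⟩ := Filter.eventually_atTop.mp
      (eventually_isAlgebraic_range_specializeLast_comp ψ hq)
    refine ⟨r₀, fun r hr => ?_⟩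
    have := h₀ r hr
    have hrank : algTrdeg K ((substVar K n (k + 2) (by omega) r).comp
        ((rename (Fin.castLE hmn)).comp ψ)).range = ((k + 2 - 1 : ℕ) : Cardinal) := by
      rw [trdeg_eq_algTrdeg, htr, Subalgebra.trdeg_eq_of_isAlgebraic]
      simp
    refine ⟨lt_of_le_of_ne (fun p hp => ?_) fun h => ?_, hrank⟩
    · rw [RingHom.mem_ker] at hp ⊢
      rw [AlgHom.comp_apply, hp, map_zero]
    · rw [trdeg_eq_algTrdeg, ← AlgHom.trdeg_range_eq_of_ker_eq h,
        AlgHom.trdeg_range_eq_of_ker_eq ((hker_rename hmn ψ).trans hψ), ← trdeg_eq_algTrdeg, hφ]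
        at hrank
      norm_cast at hrank
      omega
end

section
/- Let K be a field, A = K[x₁,…,xₙ], and φ a K-algebra endomorphism of A of rank 1, i.e., trdeg_K(image φ) = 1. Then there exists an element y ∈ A such that the image of φ is contained in the subalgebra K[y] = Algebra.adjoin K {y} generated by y. -/
open MvPolynomial

/-- Numbers with different base-`N` digits are different. -/
lemma sum_pow_mul_ne_of_lt {n N : ℕ} (hN : 1 < N) {v w : Fin n → ℕ} (hv : ∀ i, v i < N)
    (hw : ∀ i, w i < N) (hne : v ≠ w) :
    ∑ i : Fin n, N ^ (i : ℕ) * v i ≠ ∑ i : Fin n, N ^ (i : ℕ) * w i := by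
  intro h
  refine hne (List.ofFn_inj.mp ?_)
  apply Nat.ofDigits_inj_of_len_eq hN (by simp) (by simpa [List.mem_ofFn] using hv)
    (by simpa [List.mem_ofFn] using hw)
  simpa only [Nat.ofDigits_eq_sum_mapIdx, List.mapIdx_eq_ofFn, List.get_ofFn, List.length_ofFn,
    Fin.val_cast, mul_comm (N ^ _), List.sum_ofFn] using! h

/-- Kronecker substitution `x_i ↦ X ^ N ^ i`, for `N` large, keeps a given nonconstant polynomial
nonconstant. -/
lemma exists_algHom_natDegree_ne_zero {K : Type*} [Field K] {n : ℕ}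
    (f : MvPolynomial (Fin n) K) (hf : ∀ c, f ≠ C c) :
    ∃ ψ : MvPolynomial (Fin n) K →ₐ[K] Polynomial K, (ψ f).natDegree ≠ 0 := by
  obtain ⟨m, hm, hm0⟩ : ∃ m ∈ f.support, m ≠ 0 := by
    by_contra! h
    refine hf (coeff 0 f) (MvPolynomial.ext _ _ fun m ↦ ?_)
    by_cases hm : m = 0
    · simp [hm]
    · rw [coeff_C, if_neg (Ne.symm hm)]
      exact notMem_support_iff.mp fun h' ↦ hm (h m h')
  let N := 2 + f.totalDegree
  have hlt : ∀ v ∈ f.support, ∀ i, v i < N := fun v hv i ↦ by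
    have := (le_degreeOf_of_mem_support i hv).trans (degreeOf_le_totalDegree f i)
    omega
  let e : (Fin n →₀ ℕ) → ℕ := fun v ↦ ∑ i : Fin n, N ^ (i : ℕ) * v i
  let ψ : MvPolynomial (Fin n) K →ₐ[K] Polynomial K := aeval fun i ↦ Polynomial.X ^ N ^ (i : ℕ)
  have hψ : ψ f = ∑ v ∈ f.support, Polynomial.monomial (e v) (coeff v f) := by
    simp only [ψ, aeval_def, eval₂_eq', e]
    refine Finset.sum_congr rfl fun v _ ↦ ?_
    simp [← pow_mul, Finset.prod_pow_eq_pow_sum, Polynomial.C_mul_X_pow_eq_monomial]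
  have hcoeff : (ψ f).coeff (e m) = coeff m f := by
    rw [hψ, Polynomial.finsetSum_coeff, Finset.sum_eq_single m]
    · simp
    · intro v hv hvm
      rw [Polynomial.coeff_monomial, if_neg]
      exact sum_pow_mul_ne_of_lt (by omega) (hlt v hv) (hlt m hm) (by simpa using hvm)
    · exact fun h ↦ (h hm).elim
  have hem : e m ≠ 0 := by
    have := sum_pow_mul_ne_of_lt (N := N) (by omega) (hlt m hm) (w := 0) (fun _ ↦ by simp [N])
      (by simpa using! hm0)
    simpa [e] using this
  refine ⟨ψ, fun h ↦ mem_support_iff.mp hm ?_⟩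
  rw [← hcoeff]
  exact Polynomial.coeff_eq_zero_of_natDegree_lt (by omega)

/-- `K[X]` is integral over any `K`-algebra `R` mapping to it with a nonconstant value. -/
lemma Polynomial.isIntegral_of_natDegree_algebraMap_ne_zero {K R : Type*} [Field K] [CommRing R]
    [Algebra K R] [Algebra R (Polynomial K)] [IsScalarTower K R (Polynomial K)] (r : R)
    (hr : (algebraMap R (Polynomial K) r).natDegree ≠ 0) :
    Algebra.IsIntegral R (Polynomial K) := by
  set p := algebraMap R (Polynomial K) r with hp
  have hp0 : p ≠ 0 := by
    intro h
    simp [h] at hr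
  have hX : IsIntegral R (Polynomial.X : Polynomial K) := by
    have hq : (p * Polynomial.C p.leadingCoeff⁻¹).Monic := Polynomial.monic_mul_leadingCoeff_inv hp0
    have : FaithfulSMul K R := by
      have := (algebraMap R (Polynomial K)).domain_nontrivial
      infer_instance
    refine IsIntegral.of_aeval_monic (hq.map (algebraMap K R)) ?_ ?_
    · rw [Polynomial.natDegree_map_eq_of_injective (FaithfulSMul.algebraMap_injective K R),
        Polynomial.natDegree_mul_leadingCoeff_inv _ hp0]
      exact hr
    · rw [Polynomial.aeval_map_algebraMap, Polynomial.aeval_X_left_apply, hp]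
      refine isIntegral_algebraMap.mul ?_
      exact (isIntegral_algebraMap (R := K)).tower_top
  refine ⟨fun f ↦ ?_⟩
  rw [← Polynomial.aeval_X_left_apply f, Polynomial.aeval_eq_sum_range]
  exact IsIntegral.sum _ fun i _ ↦ by
    rw [Algebra.smul_def]
    exact (isIntegral_algebraMap (R := K)).tower_top.mul (hX.pow i)

open IntermediateField in
/-- Lüroth's theorem for intermediate fields of `K(X) / K` containing a nonconstant polynomial:
the generator can be taken to be a polynomial. -/
lemma RatFunc.exists_eq_adjoin_polynomial {K : Type*} [Field K]
    (E : IntermediateField K (RatFunc K)) (p : Polynomial K) (hp : p.natDegree ≠ 0)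
    (hpE : algebraMap (Polynomial K) (RatFunc K) p ∈ E) :
    ∃ u : Polynomial K, u.natDegree ≠ 0 ∧ E = K⟮algebraMap (Polynomial K) (RatFunc K) u⟯ := by
  let S : Subalgebra K (Polynomial K) :=
    E.toSubalgebra.comap (IsScalarTower.toAlgHom K (Polynomial K) (RatFunc K))
  have hS := Polynomial.isIntegral_of_natDegree_algebraMap_ne_zero (R := S) ⟨p, hpE⟩ hp
  let : Algebra S E := RingHom.toAlgebra
    (((IsScalarTower.toAlgHom K (Polynomial K) (RatFunc K)).comp S.val).codRestrict
      E.toSubalgebra fun x ↦ x.2).toRingHom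
  have : IsScalarTower S E (RatFunc K) := .of_algebraMap_eq fun x ↦ rfl
  have hX : IsIntegral S (RatFunc.X : RatFunc K) := by
    rw [← RatFunc.algebraMap_X]
    exact (hS.1 _).algebraMap
  have hc (i : ℕ) : ∃ u, algebraMap (Polynomial K) (RatFunc K) u =
      algebraMap E (RatFunc K) ((minpoly E (RatFunc.X : RatFunc K)).coeff i) := by
    have h1 := Polynomial.isIntegral_coeff_of_dvd (minpoly S (RatFunc.X : RatFunc K))
      (minpoly E RatFunc.X) (minpoly.monic hX) (minpoly.monic hX.tower_top)
      (minpoly.dvd_map_of_isScalarTower _ _ _) i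
    exact IsIntegrallyClosed.isIntegral_iff.mp (h1.algebraMap (B := RatFunc K)).tower_top
  obtain ⟨u, hu⟩ : ∃ u, algebraMap (Polynomial K) (RatFunc K) u = RatFunc.Luroth.generator E := by
    unfold RatFunc.Luroth.generator
    split
    · exact ⟨0, map_zero _⟩
    · exact hc _
  have hE : E = K⟮algebraMap (Polynomial K) (RatFunc K) u⟯ :=
    hu ▸ RatFunc.Luroth.eq_adjoin_generator
  refine ⟨u, fun h ↦ hp ?_, hE⟩
  rw [Polynomial.eq_C_of_natDegree_eq_zero h, RatFunc.algebraMap_C,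
    ← RatFunc.algebraMap_eq_C,
    adjoin_simple_eq_bot_iff.mpr (IntermediateField.algebraMap_mem _ _)] at hE
  obtain ⟨c, hc⟩ := mem_bot.mp (hE ▸ hpE)
  rw [RatFunc.algebraMap_eq_C, ← RatFunc.algebraMap_C] at hc
  rw [← RatFunc.algebraMap_injective K hc, Polynomial.natDegree_C]

open IntermediateField algebraAdjoinAdjoin in
/-- For nonconstant `u ∈ K[X]`, a polynomial lying in the field `K(u)` lies in `K[u]`. -/
lemma RatFunc.mem_adjoin_of_mem_adjoin_simple {K : Type*} [Field K] {u f : Polynomial K}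
    (hu : u.natDegree ≠ 0) (hf : algebraMap (Polynomial K) (RatFunc K) f ∈
      K⟮algebraMap (Polynomial K) (RatFunc K) u⟯) : f ∈ Algebra.adjoin K {u} := by
  let ι := IsScalarTower.toAlgHom K (Polynomial K) (RatFunc K)
  have hι : Function.Injective ι := RatFunc.algebraMap_injective K
  let U : RatFunc K := ι u
  have hU : Transcendental K U :=
    (transcendental_algebraMap_iff hι).mpr (u.transcendental hu (by
      rw [mem_nonZeroDivisors_iff_ne_zero, Polynomial.leadingCoeff_ne_zero]
      rintro rfl
      simp at hu))
  have : IsIntegrallyClosed (Algebra.adjoin K {U}) :=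
    .of_equiv (Polynomial.algEquivOfTranscendental K U hU).toRingEquiv
  have hmap : (Algebra.adjoin K {u}).map ι = Algebra.adjoin K {U} := by
    rw [AlgHom.map_adjoin, Set.image_singleton]
  have hint := Polynomial.isIntegral_of_natDegree_algebraMap_ne_zero (R := Algebra.adjoin K {u})
    ⟨u, Algebra.self_mem_adjoin_singleton K u⟩ hu
  have hfU : IsIntegral (Algebra.adjoin K {U}) (ι f) :=
    (hint.1 f).map_of_comp_eq
      (((ι.comp (Algebra.adjoin K {u}).val).codRestrict (Algebra.adjoin K {U})
        fun x ↦ hmap ▸ ⟨x, x.2, rfl⟩).toRingHom) ι.toRingHom (by ext; rfl)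
  have hfU' : IsIntegral (Algebra.adjoin K {U}) (⟨ι f, hf⟩ : K⟮U⟯) :=
    (isIntegral_algebraMap_iff (B := RatFunc K) (algebraMap K⟮U⟯ (RatFunc K)).injective).mp hfU
  obtain ⟨d, hd⟩ := IsIntegrallyClosed.isIntegral_iff.mp hfU'
  have hd' : (d : RatFunc K) = ι f := congrArg Subtype.val hd
  have hdm : (d : RatFunc K) ∈ (Algebra.adjoin K {u}).map ι := hmap.symm ▸ d.2
  obtain ⟨g, hg, hgd⟩ := hdm
  rwa [← hι (hgd.trans hd')]

/-- Let `R` be a subalgebra of an integrally closed domain `A`, and `ψ : A → K[X]` a homomorphism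
that is not constant on `R` and kills no nonzero element integral over `R`.  Then `R` lies in a
subalgebra of `A` generated by one element. -/
lemma Subalgebra.exists_le_adjoin_singleton {K A : Type*} [Field K] [CommRing A] [IsDomain A]
    [IsIntegrallyClosed A] [Algebra K A] (R : Subalgebra K A) (ψ : A →ₐ[K] Polynomial K)
    (r : R) (hr : (ψ r).natDegree ≠ 0) (hψ : ∀ g : A, IsIntegral R g → ψ g = 0 → g = 0) :
    ∃ y : A, R ≤ Algebra.adjoin K {y} := by
  let : Algebra R (Polynomial K) := (ψ.comp R.val).toRingHom.toAlgebra
  have hRψ (x : R) : algebraMap R (Polynomial K) x = ψ x := rfl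
  have : IsScalarTower K R (Polynomial K) := .of_algebraMap_eq fun c ↦ (ψ.commutes c).symm
  have hint : Algebra.IsIntegral R (Polynomial K) :=
    Polynomial.isIntegral_of_natDegree_algebraMap_ne_zero r hr
  have hinj : Function.Injective (algebraMap R (Polynomial K)) :=
    (injective_iff_map_eq_zero _).mpr fun x hx ↦ Subtype.ext (hψ x isIntegral_algebraMap hx)
  have hinj' : Function.Injective (algebraMap R (RatFunc K)) := by
    rw [IsScalarTower.algebraMap_eq R (Polynomial K) (RatFunc K)]
    exact (RatFunc.algebraMap_injective K).comp hinj
  have : IsScalarTower K R (RatFunc K) := .of_algebraMap_eq fun c ↦ by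
    rw [IsScalarTower.algebraMap_apply R (Polynomial K) (RatFunc K),
      ← IsScalarTower.algebraMap_apply K R (Polynomial K), ← IsScalarTower.algebraMap_apply]
  have hinjA : Function.Injective (algebraMap R (FractionRing A)) := by
    rw [IsScalarTower.algebraMap_eq R A (FractionRing A)]
    exact (IsFractionRing.injective A _).comp Subtype.val_injective
  let σ : FractionRing R →ₐ[R] RatFunc K :=
    { IsFractionRing.lift hinj' with commutes' := fun x ↦ IsFractionRing.lift_algebraMap hinj' x }
  let τ : FractionRing R →ₐ[R] FractionRing A :=
    { IsFractionRing.lift hinjA with commutes' := fun x ↦ IsFractionRing.lift_algebraMap hinjA x }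
  let E : IntermediateField K (RatFunc K) := (σ.restrictScalars K).fieldRange
  have hE (x : R) : algebraMap (Polynomial K) (RatFunc K) (ψ x) ∈ E :=
    ⟨algebraMap R _ x, σ.commutes x⟩
  obtain ⟨u, hu, hEu⟩ := RatFunc.exists_eq_adjoin_polynomial E (ψ r) hr (hE r)
  obtain ⟨w, hw⟩ : algebraMap (Polynomial K) (RatFunc K) u ∈ E :=
    hEu ▸ IntermediateField.mem_adjoin_simple_self K _
  replace hw : σ w = algebraMap (Polynomial K) (RatFunc K) u := hw
  have hwint : IsIntegral R w := by
    rw [← isIntegral_algHom_iff σ σ.toRingHom.injective, hw]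
    exact (hint.1 u).algebraMap
  obtain ⟨y, hy⟩ : ∃ y, algebraMap A (FractionRing A) y = τ w :=
    IsIntegrallyClosed.isIntegral_iff.mp (hwint.map τ).tower_top
  have hyint : IsIntegral R y := by
    rw [← isIntegral_algebraMap_iff (IsFractionRing.injective A (FractionRing A)), hy]
    exact hwint.map τ
  have hψy : ψ y = u := by
    obtain ⟨P, Q, hQ, rfl⟩ := IsFractionRing.div_surjective (A := R) w
    have hQ0 : Q ≠ 0 := nonZeroDivisors.ne_zero hQ
    have hyQ : y * Q = P := by
      apply IsFractionRing.injective A (FractionRing A)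
      have h0 : algebraMap R (FractionRing A) Q ≠ 0 := (map_ne_zero_iff _ hinjA).mpr hQ0
      rw [map_mul, hy, map_div₀, τ.commutes, τ.commutes]
      exact div_mul_cancel₀ _ h0
    apply RatFunc.algebraMap_injective K
    have h0 : algebraMap R (RatFunc K) Q ≠ 0 := (map_ne_zero_iff _ hinj').mpr hQ0
    rw [← hw, map_div₀, σ.commutes, σ.commutes, eq_div_iff h0,
      IsScalarTower.algebraMap_apply R (Polynomial K) (RatFunc K),
      IsScalarTower.algebraMap_apply R (Polynomial K) (RatFunc K), ← map_mul, hRψ, hRψ,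
      ← map_mul, hyQ]
  refine ⟨y, fun f hf ↦ ?_⟩
  have hfu := RatFunc.mem_adjoin_of_mem_adjoin_simple hu (hEu ▸ hE ⟨f, hf⟩)
  rw [Algebra.adjoin_singleton_eq_range_aeval] at hfu ⊢
  obtain ⟨q, hq⟩ := hfu
  refine ⟨q, (sub_eq_zero.mp (hψ (f - Polynomial.aeval y q) ?_ ?_)).symm⟩
  · refine (isIntegral_algebraMap (R := R) (x := ⟨f, hf⟩)).sub ?_
    rw [← Polynomial.aeval_map_algebraMap R, Polynomial.aeval_eq_sum_range]
    exact IsIntegral.sum _ fun i _ ↦ by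
      rw [Algebra.smul_def]
      exact isIntegral_algebraMap.mul (hyint.pow i)
  · rw [map_sub, ← Polynomial.aeval_algHom_apply, hψy, sub_eq_zero]
    exact hq.symm

/-- If the subalgebra `R` has transcendence degree one and `f ∈ R` is transcendental, then
a homomorphism under which `f` stays transcendental kills no nonzero element integral over `R`. -/
lemma Subalgebra.eq_zero_of_isIntegral_of_trdeg_eq_one {K A B : Type*} [Field K] [CommRing A]
    [IsDomain A] [Algebra K A] [CommRing B] [Algebra K B] (R : Subalgebra K A)
    (hR : Algebra.trdeg K R = 1) (ψ : A →ₐ[K] B) {f : R} (hf : Transcendental K (ψ f))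
    {g : A} (hg : IsIntegral R g) (hg0 : ψ g = 0) : g = 0 := by
  by_contra hne
  have hfK : Transcendental K f := fun h ↦ hf (h.algHom (ψ.comp R.val))
  have hbasis : IsTranscendenceBasis K ![f] :=
    AlgebraicIndependent.isTranscendenceBasis_of_lift_trdeg_le_of_finite
      (algebraicIndependent_unique_type_iff.mpr hfK) (by simp [hR])
  have := hbasis.isAlgebraic
  have hgalg : IsAlgebraic (Algebra.adjoin K (Set.range ![f])) g := hg.isAlgebraic.restrictScalars _
  obtain ⟨⟨c, hc⟩, hc0, s, hs⟩ := hgalg.exists_nonzero_dvd (mem_nonZeroDivisors_of_ne_zero hne)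
  rw [Matrix.range_cons, Matrix.range_empty, Set.union_empty,
    Algebra.adjoin_singleton_eq_range_aeval] at hc
  obtain ⟨q, rfl⟩ := hc
  have hq : ψ (Polynomial.aeval f q : R) = 0 := by
    rw [show ((Polynomial.aeval f q : R) : A) = g * s from hs, map_mul, hg0, zero_mul]
  have hq0 : Polynomial.aeval (ψ f) q = 0 := by
    rw [← hq]
    exact (Polynomial.aeval_algHom_apply (ψ.comp R.val) f q)
  refine hc0 (Subtype.ext ?_)
  simp [transcendental_iff.mp hf q hq0]

/-- The image of an endomorphism of `K[x₁,…,xₙ]` of rank `1` is contained in a subalgebra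
generated by a single element. -/
theorem stmt_17 (K : Type) [Field K] (n : ℕ)
    (φ : MvPolynomial (Fin n) K →ₐ[K] MvPolynomial (Fin n) K)
    (h : algTrdeg K ↥φ.range = 1) :
    ∃ y : MvPolynomial (Fin n) K, φ.range ≤ Algebra.adjoin K {y} := by
  have hR : Algebra.trdeg K φ.range = 1 := h
  obtain ⟨f, hf⟩ : ∃ f : φ.range, Transcendental K f := by
    by_contra! hall
    have : Algebra.IsAlgebraic K φ.range := ⟨fun f ↦ not_not.mp (hall f)⟩
    exact zero_ne_one (trdeg_eq_zero.symm.trans hR)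
  obtain ⟨ψ, hψ⟩ := exists_algHom_natDegree_ne_zero (f : MvPolynomial (Fin n) K) fun c hc ↦ hf <| by
    rw [show f = algebraMap K φ.range c from Subtype.ext hc]
    exact isAlgebraic_algebraMap c
  have hψf : Transcendental K (ψ f) := Polynomial.transcendental _ hψ <| by
    rw [mem_nonZeroDivisors_iff_ne_zero, Polynomial.leadingCoeff_ne_zero]
    intro h0
    simp [h0] at hψ
  exact φ.range.exists_le_adjoin_singleton ψ f hψ fun g hg hg0 ↦
    φ.range.eq_zero_of_isIntegral_of_trdeg_eq_one hR ψ hψf hg hg0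
end
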